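/- For every φ ∈ C_c(ℝ) and every α in the strip Ω = {z ∈ ℂ : −ln ρ(S⁻¹) ≤ Im z ≤ ln ρ(S)}, one has |∫_ℝ φ(x) e^{−iαx} dx| ≤ ‖M_φ‖, where ‖M_φ‖ is the operator norm of the convolution operator M_φ on H. -/

import Mathlib

open MeasureTheory Complex Real Filter Topology

noncomputable section

/-- A Hilbert space `H` of (locally integrable) functions on `ℝ` satisfying the
hypotheses (H1)-(H4) of the paper. -/
structure MultiplierSetup (H : Type) [NormedAddCommGroup H]
    [InnerProductSpace ℂ H] [CompleteSpace H] where
  /-- the inclusion of `H` into (a.e. classes of) functions on `ℝ` -/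
  ι : H →ₗ[ℂ] (ℝ →ₘ[volume] ℂ)
  ι_inj : Function.Injective ι
  /-- `H ⊆ L¹_loc(ℝ)` -/
  locInt : ∀ f : H, LocallyIntegrable (ι f) volume
  /-- `C_c(ℝ) ⊆ H` -/
  ofCc : CompactlySupportedContinuousMap ℝ ℂ → H
  ofCc_spec : ∀ φ : CompactlySupportedContinuousMap ℝ ℂ,
    (ι (ofCc φ) : ℝ → ℂ) =ᵐ[volume] φ
  /-- `C_c(ℝ)` is dense in `H` -/
  ofCc_dense : DenseRange ofCc
  /-- (H1): both inclusions are continuous -/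
  incl_cont : ∀ K : Set ℝ, IsCompact K → ∃ c > 0,
    (∀ φ : CompactlySupportedContinuousMap ℝ ℂ, tsupport (φ : ℝ → ℂ) ⊆ K →
      ‖ofCc φ‖ ≤ c * ⨆ x, ‖φ x‖) ∧
    (∀ f : H, (∫ x in K, ‖(ι f : ℝ → ℂ) x‖) ≤ c * ‖f‖)
  /-- (H2): the translation group acting boundedly on `H` -/
  S : ℝ → H →L[ℂ] H
  S_spec : ∀ (x : ℝ) (f : H), ((ι (S x f)) : ℝ → ℂ) =ᵐ[volume]
    fun y => (ι f : ℝ → ℂ) (y - x)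
  S_add : ∀ x y : ℝ, (S x).comp (S y) = S (x + y)
  S_zero : S 0 = 1
  S_loc_bdd : ∀ K : Set ℝ, IsCompact K → ∃ C : ℝ, ∀ x ∈ K, ‖S x‖ ≤ C
  /-- (H3): the modulations act on `H`, uniformly boundedly -/
  T : ℝ → H →L[ℂ] H
  T_spec : ∀ (α : ℝ) (f : H), ((ι (T α f)) : ℝ → ℂ) =ᵐ[volume]
    fun x => Complex.exp (Complex.I * α * x) * (ι f : ℝ → ℂ) x
  T_bdd : ∃ C : ℝ, ∀ α : ℝ, ‖T α‖ ≤ C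
  /-- (H4): exponential bound on the norms of the translations -/
  S_exp : ∃ C > 0, ∃ a ≥ 0, ∀ x : ℝ, ‖S x‖ ≤ C * Real.exp (a * |x|)

open FourierTransform in
theorem eLpNorm_fourier_eq {H : Type*} [NormedAddCommGroup H] [InnerProductSpace ℂ H]
    [CompleteSpace H] {u : ℝ → H} (h1 : Integrable u) (h2 : MemLp u 2) :
    eLpNorm (𝓕 u) 2 volume = eLpNorm u 2 volume := by
  have hcont : Continuous (𝓕 u) :=
    VectorFourier.fourierIntegral_continuous continuous_fourierChar
      (L := innerₗ ℝ) continuous_inner h1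
  have key : ∀ᵐ x, 𝓕 u x = (𝓕 (h2.toLp u) : Lp H 2 (volume : Measure ℝ)) x := by
    refine ae_eq_of_integral_contDiff_smul_eq hcont.locallyIntegrable
      ((Lp.memLp _).locallyIntegrable (by norm_num)) fun g hg hgc => ?_
    have hgc' : HasCompactSupport (fun x => (g x : ℂ)) :=
      hgc.comp_left (g := fun r : ℝ => (r : ℂ)) (by simp)
    set G : SchwartzMap ℝ ℂ := hgc'.toSchwartzMap
      (Complex.ofRealCLM.contDiff.comp hg) with hG
    have hGg (x : ℝ) : G x = (g x : ℂ) := rfl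
    have e1 := congrArg (fun D => D G) (Lp.fourier_toTemperedDistribution_eq (h2.toLp u))
    simp only [TemperedDistribution.fourier_apply, Lp.toTemperedDistribution_apply] at e1
    have e2 : ∫ x, 𝓕 G x • (h2.toLp u) x = ∫ x, 𝓕 (G : ℝ → ℂ) x • u x := by
      refine integral_congr_ae ?_
      filter_upwards [h2.coeFn_toLp] with x hx
      rw [hx, SchwartzMap.fourier_coe]
    have e3 : ∫ x, 𝓕 (G : ℝ → ℂ) x • u x = ∫ x, G x • 𝓕 u x := by
      simpa using! VectorFourier.integral_bilin_fourierIntegral_eq_flip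
        (ContinuousLinearMap.lsmul ℂ ℂ) (L := innerₗ ℝ)
        continuous_fourierChar continuous_inner G.integrable h1
    rw [e2, e3] at e1
    simpa [hGg] using e1
  rw [eLpNorm_congr_ae key]
  have := Lp.norm_fourier_eq (h2.toLp u)
  rw [Lp.norm_def, Lp.norm_def, ENNReal.toReal_eq_toReal_iff' (Lp.eLpNorm_ne_top _)
    (Lp.eLpNorm_ne_top _)] at this
  rw [this, eLpNorm_congr_ae h2.coeFn_toLp]

/-- A spectral value on the spectral circle is an approximate eigenvalue. -/
theorem exists_norm_sub_smul_lt_of_mem_spectrum {H : Type*} [NormedAddCommGroup H] [NormedSpace ℂ H]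
    [CompleteSpace H] [Nontrivial H] (A : H →L[ℂ] H) {z : ℂ} (hz : z ∈ spectrum ℂ A)
    (hr : (‖z‖₊ : ENNReal) = spectralRadius ℂ A) (hz0 : z ≠ 0) {c : ℝ} (hc : 0 < c) :
    ∃ f : H, ‖A f - z • f‖ < c * ‖f‖ := by
  by_contra! hA
  obtain ⟨ε, hε0, hε⟩ : ∃ ε : ℝ, 0 < ε ∧ 2 * (ε * ‖z‖) < c := by
    refine ⟨c / (4 * ‖z‖), by positivity, ?_⟩
    have : ‖z‖ ≠ 0 := by simpa
    field_simp
    linarith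
  set w : ℂ := (1 + ε : ℝ) • z with hw
  have hwz : ‖w - z‖ = ε * ‖z‖ := by
    have : w - z = (ε : ℂ) * z := by rw [hw, Complex.real_smul]; push_cast; ring
    rw [this, norm_mul, Complex.norm_real, Real.norm_of_nonneg hε0.le]
  have hwu : IsUnit (algebraMap ℂ (H →L[ℂ] H) w - A) := by
    have hlt : spectralRadius ℂ A < ‖w‖₊ := by
      rw [← hr, hw, nnnorm_smul]
      norm_cast
      rw [← NNReal.coe_lt_coe]
      push_cast
      rw [Real.norm_of_nonneg (by positivity)]
      nlinarith [norm_pos_iff.2 hz0]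
    exact spectrum.mem_resolventSet_of_spectralRadius_lt hlt
  obtain ⟨u, hu⟩ := hwu
  have hlow (f : H) : ε * ‖z‖ * ‖f‖ ≤ ‖(u : H →L[ℂ] H) f‖ - (c - 2 * (ε * ‖z‖)) * ‖f‖ := by
    have h1 := hA f
    have h2 : (u : H →L[ℂ] H) f = (w - z) • f - (A f - z • f) := by
      rw [hu, Algebra.algebraMap_eq_smul_one]
      simp [sub_smul]
    have h3 := norm_sub_norm_le (A f - z • f) ((w - z) • f)
    rw [norm_smul, hwz] at h3
    rw [h2, norm_sub_rev]
    nlinarith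
  have hinv : ‖((u⁻¹ : (H →L[ℂ] H)ˣ) : H →L[ℂ] H)‖ ≤ (c - ε * ‖z‖)⁻¹ := by
    have hpos : 0 < c - ε * ‖z‖ := by nlinarith [mul_pos hε0 (norm_pos_iff.2 hz0)]
    refine ContinuousLinearMap.opNorm_le_bound _ (by positivity) fun f => ?_
    have h1 := hlow (((u⁻¹ : (H →L[ℂ] H)ˣ) : H →L[ℂ] H) f)
    have h2 : (u : H →L[ℂ] H) (((u⁻¹ : (H →L[ℂ] H)ˣ) : H →L[ℂ] H) f) = f := by
      rw [← mul_apply_eq_comp, u.mul_inv]; rfl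
    rw [h2] at h1
    rw [inv_mul_eq_div, le_div_iff₀ hpos]
    linarith
  apply spectrum.mem_iff.1 hz
  refine ⟨u.ofNearby (algebraMap ℂ (H →L[ℂ] H) z - A) ?_, rfl⟩
  rw [hu, sub_sub_sub_cancel_right, ← map_sub, norm_algebraMap', norm_sub_rev, hwz]
  rw [lt_inv_comm₀ (mul_pos hε0 (norm_pos_iff.2 hz0)) (by simp)]
  refine hinv.trans_lt ?_
  have : 0 < ε * ‖z‖ := mul_pos hε0 (norm_pos_iff.2 hz0)
  rw [inv_lt_inv₀ (by linarith) this]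
  linarith

theorem norm_mul_exp_le (φ : CompactlySupportedContinuousMap ℝ ℂ) {R : ℝ}
    (hR : tsupport φ ⊆ Set.Icc (-R) R) (z : ℂ) (x : ℝ) :
    ‖φ x * Complex.exp (-(Complex.I * z * x))‖ ≤ ‖φ x‖ * Real.exp (|z.im| * R) := by
  by_cases hx : x ∈ tsupport φ
  · rw [norm_mul, Complex.norm_exp]
    gcongr
    have hx' := abs_le.2 (hR hx)
    have : (-(Complex.I * z * x)).re = z.im * x := by simp
    rw [this]
    calc z.im * x ≤ |z.im| * |x| := by rw [← abs_mul]; exact le_abs_self _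
      _ ≤ _ := by gcongr
  · simp [image_eq_zero_of_notMem_tsupport hx]

theorem exists_tsupport_subset_Icc (φ : CompactlySupportedContinuousMap ℝ ℂ) :
    ∃ R > 0, tsupport φ ⊆ Set.Icc (-R) R := by
  obtain ⟨R, hR⟩ := φ.hasCompactSupport.isCompact.isBounded.subset_closedBall 0
  refine ⟨max R 1, by simp, hR.trans ?_⟩
  rw [Real.closedBall_eq_Icc]
  exact Set.Icc_subset_Icc (by simp) (by simp)

theorem integrable_of_Cc (φ : CompactlySupportedContinuousMap ℝ ℂ) : Integrable φ :=
  φ.continuous.integrable_of_hasCompactSupport φ.hasCompactSupport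

/-- The Fourier-Laplace transform of a compactly supported function is entire. -/
theorem differentiable_fourierLaplace (φ : CompactlySupportedContinuousMap ℝ ℂ) :
    Differentiable ℂ fun z : ℂ => ∫ x : ℝ, φ x * Complex.exp (-(Complex.I * z * x)) := by
  obtain ⟨R, hR0, hR⟩ := exists_tsupport_subset_Icc φ
  intro z₀
  refine (hasDerivAt_integral_of_dominated_loc_of_deriv_le (s := Metric.ball z₀ 1)
    (F' := fun z x => φ x * (Complex.exp (-(Complex.I * z * x)) * (-(Complex.I * x))))
    (bound := fun x => ‖φ x‖ * Real.exp ((|z₀.im| + 1) * R) * R)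
    (Metric.ball_mem_nhds _ one_pos) ?_ ?_ ?_ ?_ ?_ ?_).2.differentiableAt
  · exact .of_forall fun z =>
      (φ.continuous.mul (by fun_prop)).aestronglyMeasurable
  · refine ((integrable_of_Cc φ).norm.mul_const (Real.exp (|z₀.im| * R))).mono'
      (φ.continuous.mul (by fun_prop)).aestronglyMeasurable (.of_forall fun x => ?_)
    exact norm_mul_exp_le φ hR z₀ x
  · exact (φ.continuous.mul (by fun_prop)).aestronglyMeasurable
  · refine .of_forall fun x z hz => ?_
    have him : |z.im| ≤ |z₀.im| + 1 := by
      have h1 := Complex.abs_im_le_norm (z - z₀)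
      rw [Metric.mem_ball, dist_eq_norm] at hz
      rw [Complex.sub_im] at h1
      have := abs_sub_abs_le_abs_sub z.im z₀.im
      linarith
    rw [← mul_assoc, norm_mul]
    by_cases hx : x ∈ tsupport φ
    · gcongr
      · refine (norm_mul_exp_le φ hR z x).trans ?_
        gcongr
      · simpa using abs_le.2 (hR hx)
    · simp [image_eq_zero_of_notMem_tsupport hx]
  · exact ((integrable_of_Cc φ).norm.mul_const _).mul_const _
  · refine .of_forall fun x z _ => ?_
    have h : HasDerivAt (fun z : ℂ => -(Complex.I * z * x)) (-(Complex.I * x)) z := by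
      have := (((hasDerivAt_id z).const_mul Complex.I).mul_const (x : ℂ)).fun_neg
      simpa using this
    exact h.cexp.const_mul _

theorem norm_fourierLaplace_le_of_strip (φ : CompactlySupportedContinuousMap ℝ ℂ) {a b C : ℝ}
    (ha : ∀ z : ℂ, z.im = a → ‖∫ x : ℝ, φ x * Complex.exp (-(Complex.I * z * x))‖ ≤ C)
    (hb : ∀ z : ℂ, z.im = b → ‖∫ x : ℝ, φ x * Complex.exp (-(Complex.I * z * x))‖ ≤ C)
    {z : ℂ} (hz : z.im ∈ Set.Icc a b) :
    ‖∫ x : ℝ, φ x * Complex.exp (-(Complex.I * z * x))‖ ≤ C := by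
  rcases eq_or_lt_of_le (hz.1.trans hz.2) with rfl | hab
  · exact ha z (le_antisymm hz.2 hz.1)
  obtain ⟨R, hR0, hR⟩ := exists_tsupport_subset_Icc φ
  refine PhragmenLindelof.horizontal_strip (a := a) (b := b)
    (f := fun z : ℂ => ∫ x : ℝ, φ x * Complex.exp (-(Complex.I * z * x)))
    (differentiable_fourierLaplace φ).diffContOnCl
    ⟨0, div_pos Real.pi_pos (sub_pos.2 hab), 0, ?_⟩ ha hb hz.1 hz.2
  refine Asymptotics.IsBigO.of_bound
    (∫ x, ‖φ x‖ * Real.exp ((max |a| |b|) * R)) ?_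
  refine eventually_inf_principal.2 (.of_forall fun w hw => ?_)
  simp only [zero_mul, Real.exp_zero, norm_one, mul_one]
  refine norm_integral_le_of_norm_le ((integrable_of_Cc φ).norm.mul_const _)
    (.of_forall fun x => (norm_mul_exp_le φ hR w x).trans ?_)
  gcongr
  exact abs_le_max_abs_abs hw.1.le hw.2.le

theorem eLpNorm_two_indicator_Icc {a b r : ℝ} (hr : 0 ≤ r) (hab : a ≤ b) :
    eLpNorm ((Set.Icc a b).indicator fun _ => r) 2 volume = ENNReal.ofReal (r * √(b - a)) := by
  rw [eLpNorm_indicator_const measurableSet_Icc (by norm_num) (by norm_num), Real.volume_Icc,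
    ENNReal.ofReal_mul hr, Real.sqrt_eq_rpow, ← ENNReal.ofReal_rpow_of_nonneg (by linarith)
    (by norm_num), Real.enorm_of_nonneg hr]
  norm_num

theorem memLp_of_norm_le_indicator {E : Type*} [NormedAddCommGroup E] {u : ℝ → E}
    (hu : AEStronglyMeasurable u) {a b r : ℝ}
    (h : ∀ t, ‖u t‖ ≤ (Set.Icc a b).indicator (fun _ => r) t) (p : ENNReal) : MemLp u p :=
  (memLp_indicator_const p measurableSet_Icc r (Or.inr (by simp))).mono hu
    (.of_forall fun t => (h t).trans (le_abs_self _))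

/-- The piecewise linear bump of height `1` supported in `[c - m, c + m]`. -/
def hat (c m : ℝ) (t : ℝ) : ℝ := max 0 (1 - |t - c| / m)

theorem continuous_hat (c m : ℝ) : Continuous (hat c m) := by
  unfold hat
  fun_prop

theorem hat_nonneg (c m t : ℝ) : 0 ≤ hat c m t := le_max_left _ _

theorem hat_eq_zero {c m t : ℝ} (hm : 0 < m) (ht : t ∉ Set.Icc (c - m) (c + m)) :
    hat c m t = 0 := by
  refine max_eq_left ?_
  rw [sub_nonpos, one_le_div hm]
  by_contra! h
  rw [abs_lt] at h
  exact ht ⟨by linarith, by linarith⟩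

theorem half_le_hat {c m t : ℝ} (hm : 0 < m) (ht : t ∈ Set.Icc (c - m / 2) (c + m / 2)) :
    1 / 2 ≤ hat c m t := by
  refine le_trans ?_ (le_max_right _ _)
  have : |t - c| / m ≤ 1 / 2 := by
    rw [div_le_iff₀ hm, abs_le]
    constructor <;> linarith [ht.1, ht.2]
  linarith

theorem abs_hat_sub_le (c s t : ℝ) {m : ℝ} (hm : 0 < m) :
    |hat c m s - hat c m t| ≤ |s - t| / m := by
  have h := abs_max_sub_max_le_max 0 (1 - |s - c| / m) 0 (1 - |t - c| / m)
  refine h.trans (max_le (by rw [sub_self, abs_zero]; positivity) ?_)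
  rw [sub_sub_sub_cancel_left, ← sub_div, abs_div, abs_of_pos hm]
  refine div_le_div_of_nonneg_right ?_ hm.le
  refine (abs_abs_sub_abs_le (t - c) (s - c)).trans ?_
  rw [sub_sub_sub_cancel_right, abs_sub_comm]

namespace MultiplierSetup

variable {H : Type} [NormedAddCommGroup H] [InnerProductSpace ℂ H] [CompleteSpace H]
  (P : MultiplierSetup H)

theorem ext_ae {f g : H} (h : (P.ι f : ℝ → ℂ) =ᵐ[volume] P.ι g) : f = g :=
  P.ι_inj (AEEqFun.ext h)

theorem ι_smul (c : ℂ) (f : H) :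
    (P.ι (c • f) : ℝ → ℂ) =ᵐ[volume] fun x => c * (P.ι f : ℝ → ℂ) x := by
  rw [map_smul]
  exact AEEqFun.coeFn_smul c _

theorem ofCc_sub (φ ψ : CompactlySupportedContinuousMap ℝ ℂ) :
    P.ofCc (φ - ψ) = P.ofCc φ - P.ofCc ψ := by
  apply P.ext_ae
  rw [map_sub]
  filter_upwards [P.ofCc_spec (φ - ψ), P.ofCc_spec φ, P.ofCc_spec ψ,
    AEEqFun.coeFn_sub (P.ι (P.ofCc φ)) (P.ι (P.ofCc ψ))] with x h1 h2 h3 h4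
  simp [h1, h2, h3, h4]

theorem S_apply_add (s t : ℝ) (f : H) : P.S (s + t) f = P.S s (P.S t f) := by
  rw [← P.S_add]; rfl

theorem T_neg_T (β : ℝ) (f : H) : P.T (-β) (P.T β f) = f := by
  apply P.ext_ae
  filter_upwards [P.T_spec (-β) (P.T β f), P.T_spec β f] with x h1 h2
  rw [h1, h2, ← mul_assoc, ← Complex.exp_add]
  simp

theorem S_T (t β : ℝ) (f : H) :
    P.S t (P.T β f) = Complex.exp (-(Complex.I * β * t)) • P.T β (P.S t f) := by
  apply P.ext_ae
  have hq : Measure.QuasiMeasurePreserving (fun y : ℝ => y - t) volume volume :=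
    (measurePreserving_sub_right volume t).quasiMeasurePreserving
  filter_upwards [P.S_spec t (P.T β f), hq.ae (P.T_spec β f), P.T_spec β (P.S t f), P.S_spec t f,
    P.ι_smul (Complex.exp (-(Complex.I * β * t))) (P.T β (P.S t f))] with x h1 h2 h3 h4 h5
  rw [h1, h2, h5, h3, h4, ← mul_assoc, ← Complex.exp_add]
  congr 2
  push_cast
  ring

/-- The translate `x ↦ ψ (x - t)` of a compactly supported function. -/
def translate (ψ : CompactlySupportedContinuousMap ℝ ℂ) (t : ℝ) :
    CompactlySupportedContinuousMap ℝ ℂ where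
  toFun x := ψ (x - t)
  continuous_toFun := by fun_prop
  hasCompactSupport' := ψ.hasCompactSupport.comp_homeomorph (Homeomorph.subRight t)

theorem S_ofCc (ψ : CompactlySupportedContinuousMap ℝ ℂ) (t : ℝ) :
    P.S t (P.ofCc ψ) = P.ofCc (translate ψ t) := by
  apply P.ext_ae
  have hq : Measure.QuasiMeasurePreserving (fun y : ℝ => y - t) volume volume :=
    (measurePreserving_sub_right volume t).quasiMeasurePreserving
  filter_upwards [P.S_spec t (P.ofCc ψ), hq.ae (P.ofCc_spec ψ),
    P.ofCc_spec (translate ψ t)] with x h1 h2 h3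
  rw [h1, h2, h3]
  rfl

theorem exists_norm_S_le (a b : ℝ) : ∃ C > 0, ∀ t ∈ Set.Icc a b, ‖P.S t‖ ≤ C := by
  obtain ⟨C, hC⟩ := P.S_loc_bdd (Set.Icc a b) isCompact_Icc
  exact ⟨max C 1, by simp, fun t ht => (hC t ht).trans (le_max_left _ _)⟩

theorem continuous_S_ofCc (ψ : CompactlySupportedContinuousMap ℝ ℂ) :
    Continuous fun t => P.S t (P.ofCc ψ) := by
  rw [continuous_iff_continuousAt]
  intro t₀
  obtain ⟨R, hR0, hR⟩ := exists_tsupport_subset_Icc ψ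
  obtain ⟨c, hc, hcK, -⟩ := P.incl_cont (Set.Icc (t₀ - 1 - R) (t₀ + 1 + R)) isCompact_Icc
  rw [Metric.continuousAt_iff]
  intro ε hε
  have huc := ψ.hasCompactSupport.uniformContinuous_of_continuous ψ.continuous
  obtain ⟨δ, hδ, hδψ⟩ := Metric.uniformContinuous_iff.1 huc (ε / (2 * c)) (by positivity)
  refine ⟨min δ 1, by positivity, fun t ht => ?_⟩
  have ht1 : |t - t₀| < 1 := ht.trans_le (min_le_right _ _)
  rw [abs_lt] at ht1
  rw [dist_eq_norm, S_ofCc, S_ofCc, ← ofCc_sub]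
  have hsup : tsupport (translate ψ t - translate ψ t₀ : CompactlySupportedContinuousMap ℝ ℂ) ⊆
      Set.Icc (t₀ - 1 - R) (t₀ + 1 + R) := by
    refine closure_minimal (fun x hx => ?_) isClosed_Icc
    by_contra hx'
    have aux : ∀ s ∈ Set.Ioo (t₀ - 1) (t₀ + 1), ψ (x - s) = 0 := fun s hs => by
      refine image_eq_zero_of_notMem_tsupport fun h => hx' ?_
      have := hR h
      exact ⟨by linarith [this.1, hs.1], by linarith [this.2, hs.2]⟩
    apply hx
    change ψ (x - t) - ψ (x - t₀) = 0
    rw [aux t ⟨by linarith, by linarith⟩, aux t₀ ⟨by linarith, by linarith⟩, sub_zero]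
  calc _ ≤ c * ⨆ x, ‖(translate ψ t - translate ψ t₀) x‖ := hcK _ hsup
    _ ≤ c * (ε / (2 * c)) := by
      gcongr
      refine ciSup_le fun x => ?_
      have h : dist (x - t) (x - t₀) < δ := by
        rw [dist_sub_left]
        exact ht.trans_le (min_le_left _ _)
      have := (hδψ h).le
      rwa [dist_eq_norm] at this
    _ < ε := by field_simp; linarith

theorem continuous_S (f : H) : Continuous fun t => P.S t f := by
  rw [continuous_iff_continuousAt]
  intro t₀
  obtain ⟨C, hC0, hC⟩ := P.exists_norm_S_le (t₀ - 1) (t₀ + 1)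
  rw [Metric.continuousAt_iff]
  intro ε hε
  obtain ⟨ψ, hψ⟩ := P.ofCc_dense.exists_dist_lt f (ε := ε / (3 * C)) (by positivity)
  rw [dist_eq_norm] at hψ
  obtain ⟨δ, hδ, hδψ⟩ := Metric.continuousAt_iff.1 (P.continuous_S_ofCc ψ).continuousAt
    (ε / 3) (by positivity)
  refine ⟨min δ 1, by positivity, fun t ht => ?_⟩
  have ht1 : |t - t₀| < 1 := ht.trans_le (min_le_right _ _)
  rw [abs_lt] at ht1
  have h1 : ∀ s ∈ Set.Icc (t₀ - 1) (t₀ + 1), dist (P.S s f) (P.S s (P.ofCc ψ)) < ε / 3 := by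
    intro s hs
    rw [dist_eq_norm, ← map_sub]
    calc _ ≤ C * ‖f - P.ofCc ψ‖ := ContinuousLinearMap.le_of_opNorm_le _ (hC s hs) _
      _ < C * (ε / (3 * C)) := by gcongr
      _ = ε / 3 := by field_simp
  have h2 := hδψ (ht.trans_le (min_le_left _ _))
  have h3 := h1 t ⟨by linarith, by linarith⟩
  have h4 := h1 t₀ ⟨by linarith, by linarith⟩
  rw [dist_comm] at h4
  calc _ ≤ _ := dist_triangle4 _ _ _ _
    _ < ε := by linarith

/-- Integration over a subset of a compact set, as a continuous functional on `H`. -/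
def setIntegralCLM {K A : Set ℝ} (hK : IsCompact K) (hA : A ⊆ K) : H →L[ℂ] ℂ :=
  LinearMap.mkContinuousOfExistsBound
    { toFun := fun f => ∫ x in A, (P.ι f : ℝ → ℂ) x
      map_add' := fun f g => by
        rw [← integral_add (((P.locInt f).integrableOn_isCompact hK).mono_set hA)
          (((P.locInt g).integrableOn_isCompact hK).mono_set hA), map_add]
        exact integral_congr_ae (ae_restrict_of_ae (AEEqFun.coeFn_add _ _))
      map_smul' := fun c f => by
        rw [RingHom.id_apply, smul_eq_mul, ← integral_const_mul]
        exact integral_congr_ae (ae_restrict_of_ae (P.ι_smul c f)) } <| by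
    obtain ⟨c, -, -, hc⟩ := P.incl_cont K hK
    refine ⟨c, fun f => le_trans ?_ (hc f)⟩
    refine (norm_integral_le_integral_norm _).trans ?_
    exact setIntegral_mono_set ((P.locInt f).integrableOn_isCompact hK).norm
      (.of_forall fun x => norm_nonneg _) hA.eventuallyLE

theorem setIntegralCLM_apply {K A : Set ℝ} (hK : IsCompact K) (hA : A ⊆ K) (f : H) :
    P.setIntegralCLM hK hA f = ∫ x in A, (P.ι f : ℝ → ℂ) x := rfl

theorem integrable_smul_S (φ : CompactlySupportedContinuousMap ℝ ℂ) (f : H) :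
    Integrable fun y => φ y • P.S y f :=
  (φ.continuous.smul (P.continuous_S f)).integrable_of_hasCompactSupport
    φ.hasCompactSupport.smul_right

/-- The convolution operator by `φ`, as a vector-valued integral of translations. -/
def integralS (φ : CompactlySupportedContinuousMap ℝ ℂ) : H →L[ℂ] H :=
  LinearMap.mkContinuousOfExistsBound
    { toFun := fun f => ∫ y, φ y • P.S y f
      map_add' := fun f g => by
        rw [← integral_add (P.integrable_smul_S φ f) (P.integrable_smul_S φ g)]
        simp
      map_smul' := fun c f => by
        rw [RingHom.id_apply, ← integral_smul]
        simp [smul_comm c] } <| by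
    obtain ⟨R, hR0, hR⟩ := exists_tsupport_subset_Icc φ
    obtain ⟨C, hC0, hC⟩ := P.exists_norm_S_le (-R) R
    refine ⟨∫ y, ‖φ y‖ * C, fun f => ?_⟩
    rw [← integral_mul_const]
    refine norm_integral_le_of_norm_le (((integrable_of_Cc φ).norm.mul_const _).mul_const _)
      (.of_forall fun y => ?_)
    rw [norm_smul, mul_assoc]
    by_cases hy : y ∈ tsupport φ
    · gcongr
      exact ContinuousLinearMap.le_of_opNorm_le _ (hC y (hR hy)) _
    · simp [image_eq_zero_of_notMem_tsupport hy]

theorem integralS_apply (φ : CompactlySupportedContinuousMap ℝ ℂ) (f : H) :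
    P.integralS φ f = ∫ y, φ y • P.S y f := rfl

theorem ι_integralS_ofCc (φ ψ : CompactlySupportedContinuousMap ℝ ℂ) :
    (P.ι (P.integralS φ (P.ofCc ψ)) : ℝ → ℂ) =ᵐ[volume] fun x => ∫ y, ψ (x - y) * φ y := by
  have hconv : Integrable (fun p : ℝ × ℝ => ψ (p.1 - p.2) * φ p.2) (volume.prod volume) := by
    have := (integrable_of_Cc φ).convolution_integrand (ContinuousLinearMap.mul ℂ ℂ).flip
      (integrable_of_Cc ψ)
    simpa [mul_comm] using this
  have key (n : ℕ) : ∀ᵐ x ∂(volume.restrict (Set.Icc (-n : ℝ) n)),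
      (P.ι (P.integralS φ (P.ofCc ψ)) : ℝ → ℂ) x = ∫ y, ψ (x - y) * φ y := by
    have hK : IsCompact (Set.Icc (-n : ℝ) n) := isCompact_Icc
    refine Integrable.ae_eq_of_forall_setIntegral_eq _ _
      ((P.locInt _).integrableOn_isCompact hK) hconv.integral_prod_left.integrableOn
      fun B hB _ => ?_
    rw [Measure.restrict_restrict hB]
    rw [← P.setIntegralCLM_apply hK Set.inter_subset_right, integralS_apply,
      ← ContinuousLinearMap.integral_comp_comm _ (P.integrable_smul_S φ _)]
    have hconv' : Integrable (Function.uncurry fun x y => ψ (x - y) * φ y)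
        ((volume.restrict (B ∩ Set.Icc (-n : ℝ) n)).prod volume) := by
      rw [show (volume.restrict (B ∩ Set.Icc (-n : ℝ) n)).prod (volume : Measure ℝ) =
        (volume.prod volume).restrict ((B ∩ Set.Icc (-n : ℝ) n) ×ˢ Set.univ) by
          rw [← Measure.prod_restrict, Measure.restrict_univ]]
      exact hconv.integrableOn
    rw [integral_integral_swap hconv']
    refine integral_congr_ae (.of_forall fun y => ?_)
    dsimp only
    rw [map_smul, S_ofCc, setIntegralCLM_apply, smul_eq_mul, mul_comm, ← integral_mul_const]
    refine integral_congr_ae (ae_restrict_of_ae ?_)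
    filter_upwards [P.ofCc_spec (translate ψ y)] with x hx
    rw [hx]
    rfl
  have hU : (⋃ n : ℕ, Set.Icc (-n : ℝ) n) = Set.univ := by
    refine Set.eq_univ_of_forall fun x => Set.mem_iUnion.2 ?_
    obtain ⟨n, hn⟩ := exists_nat_ge |x|
    exact ⟨n, abs_le.1 hn⟩
  have := (ae_restrict_iUnion_iff (μ := volume) (fun n : ℕ => Set.Icc (-n : ℝ) n) _).2 key
  rwa [hU, Measure.restrict_univ] at this

theorem eq_integralS (φ : CompactlySupportedContinuousMap ℝ ℂ) (N : H →L[ℂ] H)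
    (hN : ∀ f : H, (P.ι (N f) : ℝ → ℂ) =ᵐ[volume]
      fun x => ∫ y : ℝ, (P.ι f : ℝ → ℂ) (x - y) * φ y) : N = P.integralS φ := by
  have h : (N : H → H) = P.integralS φ := by
    refine P.ofCc_dense.equalizer N.continuous (P.integralS φ).continuous (funext fun ψ => ?_)
    apply P.ext_ae
    refine (hN _).trans (EventuallyEq.trans (.of_forall fun x => ?_) (P.ι_integralS_ofCc φ ψ).symm)
    refine integral_congr_ae ?_
    have hq : Measure.QuasiMeasurePreserving (fun y : ℝ => x - y) volume volume :=
      (Measure.measurePreserving_sub_left volume x).quasiMeasurePreserving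
    filter_upwards [hq.ae (P.ofCc_spec ψ)] with y hy
    rw [hy]
  exact ContinuousLinearMap.ext (congrFun h)

/-- The orbit of `f` under the rescaled translation group `e^{iαt} S_t`. -/
def orbit (α : ℂ) (f : H) (t : ℝ) : H := Complex.exp (Complex.I * α * t) • P.S t f

theorem continuous_orbit (α : ℂ) (f : H) : Continuous (P.orbit α f) :=
  Continuous.smul (by fun_prop) (P.continuous_S f)

theorem orbit_sub (α : ℂ) (f g : H) (t : ℝ) :
    P.orbit α (f - g) t = P.orbit α f t - P.orbit α g t := by
  simp [orbit, smul_sub]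

theorem orbit_zero (α : ℂ) (f : H) : P.orbit α f 0 = f := by
  simp [orbit, P.S_zero]

theorem orbit_orbit (α : ℂ) (f : H) (s t : ℝ) :
    P.orbit α (P.orbit α f t) s = P.orbit α f (s + t) := by
  simp only [orbit, map_smul, smul_smul, ← Complex.exp_add, P.S_apply_add]
  congr 2
  push_cast
  ring

theorem orbit_T (α : ℂ) (β : ℝ) (f : H) (t : ℝ) :
    P.orbit α (P.T β f) t = P.T β (P.orbit (α - β) f t) := by
  simp only [orbit, map_smul, S_T, smul_smul, ← Complex.exp_add]
  congr 2
  ring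

theorem exists_norm_T_le : ∃ C > 0, ∀ β f, ‖P.T β f‖ ≤ C * ‖f‖ := by
  obtain ⟨C, hC⟩ := P.T_bdd
  exact ⟨max C 1, by simp, fun β f =>
    ContinuousLinearMap.le_of_opNorm_le _ ((hC β).trans (le_max_left _ _)) _⟩

theorem exists_norm_orbit_le (α : ℂ) (a b : ℝ) :
    ∃ C > 0, ∀ t ∈ Set.Icc a b, ∀ f, ‖P.orbit α f t‖ ≤ C * ‖f‖ := by
  obtain ⟨C, hC0, hC⟩ := P.exists_norm_S_le a b
  obtain ⟨B, hB⟩ := isCompact_Icc.exists_bound_of_continuousOn (s := Set.Icc a b)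
    (f := fun t : ℝ => Complex.exp (Complex.I * α * t)) (by fun_prop)
  refine ⟨max B 1 * C, by positivity, fun t ht f => ?_⟩
  rw [orbit, norm_smul]
  calc _ ≤ max B 1 * (C * ‖f‖) := by
        gcongr
        · exact (hB t ht).trans (le_max_left _ _)
        · exact ContinuousLinearMap.le_of_opNorm_le _ (hC t ht) _
    _ = _ := by ring

/-- Approximate fixed vectors of `e^{iα} S_1` have orbits of essentially constant norm. -/
theorem exists_norm_orbit_bounds (α : ℂ) : ∃ c > 0, ∃ C > 0, ∀ L : ℝ, ∃ ε > 0, ∀ f,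
    ‖P.orbit α f 1 - f‖ ≤ ε * ‖f‖ →
      ∀ t ∈ Set.Icc 0 L, c * ‖f‖ ≤ ‖P.orbit α f t‖ ∧ ‖P.orbit α f t‖ ≤ C * ‖f‖ := by
  obtain ⟨A, hA0, hA⟩ := P.exists_norm_orbit_le α (-1) 1
  refine ⟨(2 * A)⁻¹, by positivity, A * 2, by positivity, fun L => ?_⟩
  have key : ∀ n : ℕ, ∃ B > 0, ∀ f, ‖P.orbit α f n - f‖ ≤ B * ‖P.orbit α f 1 - f‖ := by
    intro n
    induction n with
    | zero => exact ⟨1, one_pos, fun f => by simp [orbit_zero]⟩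
    | succ n ih =>
      obtain ⟨B, hB0, hB⟩ := ih
      refine ⟨A * B + 1, by positivity, fun f => ?_⟩
      have h1 : P.orbit α f ((n + 1 : ℕ) : ℝ) - f =
          P.orbit α (P.orbit α f n - f) 1 + (P.orbit α f 1 - f) := by
        rw [orbit_sub, orbit_orbit]
        push_cast
        rw [add_comm (n : ℝ)]
        abel
      rw [h1]
      calc _ ≤ _ := norm_add_le _ _
        _ ≤ A * (B * ‖P.orbit α f 1 - f‖) + ‖P.orbit α f 1 - f‖ := by
          gcongr
          refine (hA 1 (by norm_num) _).trans ?_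
          gcongr
          exact hB f
        _ = _ := by ring
  choose B hB0 hB using key
  obtain ⟨n, hn⟩ := exists_nat_ge L
  have hM : 0 < ∑ i ∈ Finset.range (n + 1), B i := Finset.sum_pos (fun i _ => hB0 i) (by simp)
  refine ⟨(2 * ∑ i ∈ Finset.range (n + 1), B i)⁻¹, by positivity, fun f hf t ht => ?_⟩
  set j := ⌊t⌋₊
  have hj1 : (j : ℝ) ≤ t := Nat.floor_le ht.1
  have hj2 : t < j + 1 := Nat.lt_floor_add_one t
  have hjn : j < n + 1 := by
    have : (j : ℝ) < n + 1 := by linarith [ht.2]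
    exact_mod_cast this
  have hclose : ‖P.orbit α f j - f‖ ≤ ‖f‖ / 2 := by
    calc _ ≤ B j * ‖P.orbit α f 1 - f‖ := hB j f
      _ ≤ (∑ i ∈ Finset.range (n + 1), B i) *
          ((2 * ∑ i ∈ Finset.range (n + 1), B i)⁻¹ * ‖f‖) := by
        gcongr
        exact Finset.single_le_sum (f := B) (fun i _ => (hB0 i).le) (Finset.mem_range.2 hjn)
      _ = ‖f‖ / 2 := by field_simp
  have hup : ‖P.orbit α f j‖ ≤ 2 * ‖f‖ := by
    have := norm_sub_norm_le (P.orbit α f j) f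
    linarith [norm_nonneg f]
  have hlow : ‖f‖ / 2 ≤ ‖P.orbit α f j‖ := by
    have := norm_sub_norm_le f (P.orbit α f j)
    rw [norm_sub_rev] at this
    linarith
  constructor
  · have h := hA (j - t) ⟨by linarith, by linarith⟩ (P.orbit α f t)
    rw [orbit_orbit, sub_add_cancel] at h
    rw [inv_mul_le_iff₀ (by positivity)]
    linarith
  · have h := hA (t - j) ⟨by linarith, by linarith⟩ (P.orbit α f j)
    rw [orbit_orbit, sub_add_cancel] at h
    rw [mul_assoc]
    exact h.trans (by gcongr)

open scoped Pointwise in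
/-- On smeared orbits the convolution operator differs from the scalar `φ̂(α)` by an orbit smeared
with the convolution commutator kernel. -/
theorem integralS_integral_orbit (φ : CompactlySupportedContinuousMap ℝ ℂ) (α : ℂ) (f : H)
    {θ : ℝ → ℂ} (hθ : Continuous θ) (hθc : HasCompactSupport θ) :
    P.integralS φ (∫ t, θ t • P.orbit α f t) -
        (∫ x : ℝ, φ x * Complex.exp (-(Complex.I * α * x))) • ∫ t, θ t • P.orbit α f t =
      ∫ t, (∫ y : ℝ, φ y * Complex.exp (-(Complex.I * α * y)) * (θ (t - y) - θ t)) •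
        P.orbit α f t := by
  set g : ℝ → ℂ := fun y => φ y * Complex.exp (-(Complex.I * α * y)) with hg
  have hgcont : Continuous g := φ.continuous.mul (by fun_prop)
  have hgc : HasCompactSupport g := φ.hasCompactSupport.mul_right
  have hv := P.continuous_orbit α f
  set h := ∫ t, θ t • P.orbit α f t with hh
  have hconv (y : ℝ) : Integrable fun t => θ (t - y) • P.orbit α f t := by
    refine Continuous.integrable_of_hasCompactSupport (by fun_prop) (HasCompactSupport.smul_right ?_)
    exact hθc.comp_homeomorph (Homeomorph.subRight y)
  have horb (y : ℝ) : P.orbit α h y = ∫ t, θ (t - y) • P.orbit α f t := by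
    have h0 : Integrable fun t => θ t • P.orbit α f t := by simpa using hconv 0
    rw [orbit, hh, ← ContinuousLinearMap.integral_comp_comm _ h0, ← integral_smul,
      ← integral_sub_right_eq_self _ y]
    congr 1 with t
    rw [map_smul, smul_comm]
    congr 1
    have := P.orbit_orbit α f y (t - y)
    rw [add_sub_cancel] at this
    rw [← this]
    rfl
  have hgi : Integrable g := hgcont.integrable_of_hasCompactSupport hgc
  have hprod : Integrable (Function.uncurry fun y t : ℝ =>
      (g y * (θ (t - y) - θ t)) • P.orbit α f t) (volume.prod volume) := by
    refine Continuous.integrable_of_hasCompactSupport (by fun_prop) ?_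
    refine HasCompactSupport.of_support_subset_isCompact
      (K := tsupport g ×ˢ (tsupport θ ∪ (tsupport θ + tsupport g)))
      (hgc.isCompact.prod (hθc.isCompact.union (hθc.isCompact.add hgc.isCompact))) ?_
    rintro ⟨y, t⟩ hyt
    simp only [Function.mem_support, Function.uncurry_apply_pair, smul_ne_zero_iff,
      mul_ne_zero_iff] at hyt
    refine ⟨subset_tsupport _ hyt.1.1, ?_⟩
    by_contra hn
    rw [Set.mem_union, not_or] at hn
    apply hyt.1.2
    have hty : t - y ∉ tsupport θ := fun hty =>
      hn.2 ⟨t - y, hty, y, subset_tsupport _ hyt.1.1, by simp⟩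
    rw [image_eq_zero_of_notMem_tsupport hn.1, image_eq_zero_of_notMem_tsupport hty, sub_zero]
  have horbi : Integrable fun y => g y • P.orbit α h y :=
    (hgcont.smul (P.continuous_orbit α h)).integrable_of_hasCompactSupport hgc.smul_right
  calc _ = (∫ y, g y • P.orbit α h y) - ∫ y, g y • h := by
        rw [integralS_apply, integral_smul_const]
        congr 2 with y
        rw [orbit, smul_smul, hg]
        dsimp only
        rw [mul_assoc, ← Complex.exp_add]
        simp
    _ = ∫ y, ∫ t, (g y * (θ (t - y) - θ t)) • P.orbit α f t := by
        rw [← integral_sub horbi (hgi.smul_const h)]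
        congr 1 with y
        rw [horb, ← smul_sub, hh, ← integral_sub (hconv y) (by simpa using hconv 0), ← integral_smul]
        congr 1 with t
        rw [← sub_smul, smul_smul]
    _ = _ := by
        rw [integral_integral_swap hprod]
        congr 1 with t
        rw [integral_smul_const]

open FourierTransform in
theorem integral_smul_orbit_T (k : ℝ → ℂ) (α : ℂ) (f : H) (ξ : ℝ)
    (hk : Integrable fun t => k t • P.orbit α f t) :
    ∫ t, k t • P.orbit α (P.T (2 * π * ξ) f) t =
      P.T (2 * π * ξ) (𝓕 (fun t => k t • P.orbit α f t) ξ) := by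
  rw [Real.fourier_real_eq_integral_exp_smul, ← ContinuousLinearMap.integral_comp_comm]
  · congr 1 with t
    have he : Complex.exp (Complex.I * (α - (2 * π * ξ : ℝ)) * t) =
        Complex.exp ((-2 * π * t * ξ : ℝ) * I) * Complex.exp (Complex.I * α * t) := by
      rw [← Complex.exp_add]
      congr 1
      push_cast
      ring
    rw [orbit_T]
    simp only [orbit, map_smul, smul_smul, he]
    congr 1
    ring
  · refine (integrable_norm_iff ?_).1 ?_
    · exact AEStronglyMeasurable.smul (by fun_prop) hk.aestronglyMeasurable
    · simpa [norm_smul, Complex.norm_exp] using hk.norm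

open FourierTransform in
/-- If `|φ̂(α)|` exceeds the norm of the convolution operator, then smeared orbits are controlled by
orbits smeared with the commutator kernel, uniformly in the smearing function. -/
theorem exists_eLpNorm_smul_orbit_le (φ : CompactlySupportedContinuousMap ℝ ℂ) (α : ℂ)
    (hα : ‖P.integralS φ‖ < ‖∫ x : ℝ, φ x * Complex.exp (-(Complex.I * α * x))‖) :
    ∃ K > 0, ∀ (f : H) (θ k : ℝ → ℂ), Continuous θ → HasCompactSupport θ →
      (∀ t, k t = ∫ y : ℝ, φ y * Complex.exp (-(Complex.I * α * y)) * (θ (t - y) - θ t)) →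
      MemLp (fun t => k t • P.orbit α f t) 1 → MemLp (fun t => k t • P.orbit α f t) 2 →
      eLpNorm (fun t => θ t • P.orbit α f t) 2 volume ≤
        ENNReal.ofReal K * eLpNorm (fun t => k t • P.orbit α f t) 2 volume := by
  obtain ⟨C, hC0, hC⟩ := P.exists_norm_T_le
  set F := ∫ x : ℝ, φ x * Complex.exp (-(Complex.I * α * x)) with hF
  have hη : 0 < ‖F‖ - ‖P.integralS φ‖ := sub_pos.2 hα
  refine ⟨C * (C / (‖F‖ - ‖P.integralS φ‖)), by positivity, fun f θ k hθ hθc hk hk1 hk2 => ?_⟩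
  have hcont : Continuous fun t => θ t • P.orbit α f t := hθ.smul (P.continuous_orbit α f)
  have hθ1 : Integrable fun t => θ t • P.orbit α f t :=
    hcont.integrable_of_hasCompactSupport hθc.smul_right
  have hθ2 : MemLp (fun t => θ t • P.orbit α f t) 2 :=
    hcont.memLp_of_hasCompactSupport hθc.smul_right
  rw [memLp_one_iff_integrable] at hk1
  rw [← eLpNorm_fourier_eq hθ1 hθ2, ← eLpNorm_fourier_eq hk1 hk2]
  refine eLpNorm_le_mul_eLpNorm_of_ae_le_mul (.of_forall fun ξ => ?_) 2
  set h := ∫ t, θ t • P.orbit α (P.T (2 * π * ξ) f) t with hh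
  have e1 := P.integral_smul_orbit_T θ α f ξ hθ1
  have e2 := P.integral_smul_orbit_T k α f ξ hk1
  have e3 := P.integralS_integral_orbit φ α (P.T (2 * π * ξ) f) hθ hθc
  simp_rw [← hk] at e3
  rw [e2, ← hh, ← hF] at e3
  have h1 : (‖F‖ - ‖P.integralS φ‖) * ‖h‖ ≤ C * ‖𝓕 (fun t => k t • P.orbit α f t) ξ‖ := by
    refine le_trans ?_ (hC (2 * π * ξ) _)
    rw [← e3, norm_sub_rev]
    have := norm_sub_norm_le (F • h) (P.integralS φ h)
    rw [norm_smul] at this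
    have := (P.integralS φ).le_opNorm h
    linarith
  have h2 : ‖𝓕 (fun t => θ t • P.orbit α f t) ξ‖ ≤ C * ‖h‖ := by
    rw [hh, e1]
    simpa [T_neg_T] using
      hC (-(2 * π * ξ)) (P.T (2 * π * ξ) (𝓕 (fun t => θ t • P.orbit α f t) ξ))
  calc _ ≤ C * ‖h‖ := h2
    _ ≤ C * (C * ‖𝓕 (fun t => k t • P.orbit α f t) ξ‖ / (‖F‖ - ‖P.integralS φ‖)) := by
        gcongr
        rw [le_div_iff₀ hη]
        linarith
    _ = _ := by ring

/-- If `e^{iα} S_1` has approximate fixed vectors, then `|φ̂(α)|` is at most the norm of the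
convolution operator. -/
theorem norm_fourierLaplace_le_of_approx (φ : CompactlySupportedContinuousMap ℝ ℂ) (α : ℂ)
    (happ : ∀ ε > 0, ∃ f, ‖P.orbit α f 1 - f‖ < ε * ‖f‖) :
    ‖∫ x : ℝ, φ x * Complex.exp (-(Complex.I * α * x))‖ ≤ ‖P.integralS φ‖ := by
  by_contra! hα
  obtain ⟨K, hK0, hK⟩ := P.exists_eLpNorm_smul_orbit_le φ α hα
  obtain ⟨c, hc0, C, hC0, hcC⟩ := P.exists_norm_orbit_bounds α
  obtain ⟨R, hR0, hR⟩ := exists_tsupport_subset_Icc φ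
  set g : ℝ → ℂ := fun y => φ y * Complex.exp (-(Complex.I * α * y)) with hg
  have hgcont : Continuous g := φ.continuous.mul (by fun_prop)
  have hgi : Integrable g :=
    hgcont.integrable_of_hasCompactSupport φ.hasCompactSupport.mul_right
  have hg0 {y : ℝ} (hy : y ∉ Set.Icc (-R) R) : g y = 0 := by
    simp [hg, image_eq_zero_of_notMem_tsupport fun h => hy (hR h)]
  set B := (∫ y, ‖g y‖) * R with hB
  have hB0 : 0 ≤ B := mul_nonneg (integral_nonneg fun y => norm_nonneg _) hR0.le
  set m := R + 4 * K * B * C / c + 1 with hm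
  have hmq : 0 ≤ 4 * K * B * C / c := by positivity
  have hm0 : 0 < m := by linarith
  obtain ⟨ε, hε0, hε⟩ := hcC (4 * m)
  obtain ⟨f, hf⟩ := happ ε hε0
  have hf0 : 0 < ‖f‖ := by
    by_contra! h
    have h' : ‖f‖ = 0 := le_antisymm h (norm_nonneg _)
    rw [h', mul_zero] at hf
    exact absurd hf (norm_nonneg _).not_gt
  replace hε := hε f hf.le
  set θ : ℝ → ℂ := fun t => (hat (R + m) m t : ℂ) with hθ
  have hθcont : Continuous θ := Complex.continuous_ofReal.comp (continuous_hat _ _)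
  have hθ0 {t : ℝ} (ht : t ∉ Set.Icc R (R + 2 * m)) : θ t = 0 := by
    rw [hθ]
    dsimp only
    rw [hat_eq_zero hm0, Complex.ofReal_zero]
    convert ht using 3 <;> ring
  have hθc : HasCompactSupport θ := HasCompactSupport.intro isCompact_Icc fun t => hθ0
  set k : ℝ → ℂ := fun t => ∫ y, g y * (θ (t - y) - θ t) with hk
  have hkm : AEStronglyMeasurable k := by
    have : Continuous fun p : ℝ × ℝ => g p.2 * (θ (p.1 - p.2) - θ p.1) := by fun_prop
    exact (this.aestronglyMeasurable (μ := volume.prod volume)).integral_prod_right'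
  have hkb (t : ℝ) : ‖k t‖ ≤ B / m := by
    have : B / m = ∫ y, ‖g y‖ * (R / m) := by rw [integral_mul_const]; ring
    rw [this]
    refine norm_integral_le_of_norm_le (hgi.norm.mul_const _) (.of_forall fun y => ?_)
    rw [norm_mul]
    by_cases hy : y ∈ Set.Icc (-R) R
    · gcongr
      rw [hθ]
      dsimp only
      rw [← Complex.ofReal_sub, Complex.norm_real, Real.norm_eq_abs]
      refine (abs_hat_sub_le _ _ _ hm0).trans ?_
      gcongr
      rw [sub_sub_cancel_left, abs_neg]
      exact abs_le.2 hy
    · simp [hg0 hy]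
  have hk0 {t : ℝ} (ht : t ∉ Set.Icc 0 (4 * m)) : k t = 0 := by
    rw [hk]
    dsimp only
    refine integral_eq_zero_of_ae (.of_forall fun y => ?_)
    by_cases hy : y ∈ Set.Icc (-R) R
    · have h1 : θ t = 0 := hθ0 fun h => ht ⟨by linarith [h.1], by linarith [h.2]⟩
      have h2 : θ (t - y) = 0 := hθ0 fun h =>
        ht ⟨by linarith [h.1, hy.1], by linarith [h.2, hy.2]⟩
      simp [h1, h2]
    · simp [hg0 hy]
  have hkle (t : ℝ) : ‖k t • P.orbit α f t‖ ≤
      (Set.Icc 0 (4 * m)).indicator (fun _ => B / m * (C * ‖f‖)) t := by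
    by_cases ht : t ∈ Set.Icc 0 (4 * m)
    · rw [Set.indicator_of_mem ht, norm_smul]
      gcongr
      exacts [hkb t, (hε t ht).2]
    · rw [Set.indicator_of_notMem ht, hk0 ht, zero_smul, norm_zero]
  have hθle (t : ℝ) : ‖(Set.Icc (R + m - m / 2) (R + m + m / 2)).indicator
      (fun _ => 1 / 2 * (c * ‖f‖)) t‖ ≤ ‖θ t • P.orbit α f t‖ := by
    by_cases ht : t ∈ Set.Icc (R + m - m / 2) (R + m + m / 2)
    · rw [Set.indicator_of_mem ht, norm_smul, Real.norm_of_nonneg (by positivity), hθ,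
        Complex.norm_real, Real.norm_of_nonneg (hat_nonneg _ _ _)]
      gcongr
      · exact hat_nonneg _ _ _
      · exact half_le_hat hm0 ht
      · exact (hε t ⟨by linarith [ht.1], by linarith [ht.2]⟩).1
    · rw [Set.indicator_of_notMem ht, norm_zero]
      exact norm_nonneg _
  have hkm' : AEStronglyMeasurable fun t => k t • P.orbit α f t :=
    hkm.smul (P.continuous_orbit α f).aestronglyMeasurable
  have main := hK f θ k hθcont hθc (fun t => rfl) (memLp_of_norm_le_indicator hkm' hkle 1)
    (memLp_of_norm_le_indicator hkm' hkle 2)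
  have lower := eLpNorm_mono (p := 2) (μ := (volume : Measure ℝ)) hθle
  have upper := eLpNorm_mono_real (p := 2) (μ := (volume : Measure ℝ)) hkle
  rw [eLpNorm_two_indicator_Icc (by positivity) (by linarith)] at lower upper
  have fin := lower.trans (main.trans (mul_le_mul_right upper _))
  rw [← ENNReal.ofReal_mul hK0.le, ENNReal.ofReal_le_ofReal_iff (by positivity)] at fin
  have hs1 : R + m + m / 2 - (R + m - m / 2) = m := by ring
  have hs2 : √(4 * m - 0) = 2 * √m := by
    rw [sub_zero, Real.sqrt_mul (by norm_num), show (4 : ℝ) = 2 ^ 2 by norm_num,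
      Real.sqrt_sq (by norm_num)]
  rw [hs1, hs2] at fin
  have hsm : 0 < √m := Real.sqrt_pos.2 hm0
  have fin' : c / 2 * (‖f‖ * √m) ≤ 2 * K * B * C / m * (‖f‖ * √m) := by
    calc _ = 1 / 2 * (c * ‖f‖) * √m := by ring
      _ ≤ _ := fin
      _ = _ := by ring
  have fin'' := le_of_mul_le_mul_right fin' (by positivity)
  rw [le_div_iff₀ hm0] at fin''
  have : m * c = R * c + 4 * K * B * C + c := by
    rw [hm]
    field_simp
  nlinarith [mul_pos hR0 hc0]

/-- Modulation moves approximate fixed vectors horizontally. -/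
theorem approx_add_real {α : ℂ} (β : ℝ) (happ : ∀ ε > 0, ∃ f, ‖P.orbit α f 1 - f‖ < ε * ‖f‖) :
    ∀ ε > 0, ∃ f, ‖P.orbit (α + β) f 1 - f‖ < ε * ‖f‖ := by
  obtain ⟨C, hC0, hC⟩ := P.exists_norm_T_le
  intro ε hε
  obtain ⟨f, hf⟩ := happ (ε / (C * C)) (by positivity)
  refine ⟨P.T β f, ?_⟩
  rw [orbit_T, add_sub_cancel_right, ← map_sub]
  have h1 : ‖f‖ ≤ C * ‖P.T β f‖ := by simpa [T_neg_T] using hC (-β) (P.T β f)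
  calc _ ≤ C * ‖P.orbit α f 1 - f‖ := hC _ _
    _ < C * (ε / (C * C) * ‖f‖) := by gcongr
    _ ≤ C * (ε / (C * C) * (C * ‖P.T β f‖)) := by gcongr
    _ = _ := by field_simp

theorem norm_fourierLaplace_le_of_im_eq (φ : CompactlySupportedContinuousMap ℝ ℂ) {α₀ α : ℂ}
    (him : α.im = α₀.im) (happ : ∀ ε > 0, ∃ f, ‖P.orbit α₀ f 1 - f‖ < ε * ‖f‖) :
    ‖∫ x : ℝ, φ x * Complex.exp (-(Complex.I * α * x))‖ ≤ ‖P.integralS φ‖ := by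
  apply P.norm_fourierLaplace_le_of_approx
  have : α = α₀ + ((α.re - α₀.re : ℝ) : ℂ) := by
    apply Complex.ext <;> simp [him]
  rw [this]
  exact P.approx_add_real _ happ

theorem isUnit_S (t : ℝ) : IsUnit (P.S t) :=
  ⟨⟨P.S t, P.S (-t), by rw [ContinuousLinearMap.mul_def, P.S_add, add_neg_cancel, P.S_zero],
    by rw [ContinuousLinearMap.mul_def, P.S_add, neg_add_cancel, P.S_zero]⟩, rfl⟩

theorem exists_approx_eigenvalue_S [Nontrivial H] (t : ℝ) : ∃ z : ℂ, z ≠ 0 ∧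
    (spectralRadius ℂ (P.S t)).toReal = ‖z‖ ∧
    ∀ ε > 0, ∃ f, ‖P.S t f - z • f‖ < ε * ‖f‖ := by
  obtain ⟨z, hz, hr⟩ := spectrum.exists_nnnorm_eq_spectralRadius (P.S t)
  have hz0 : z ≠ 0 := by
    rintro rfl
    exact spectrum.zero_notMem ℂ (P.isUnit_S t) hz
  exact ⟨z, hz0, by rw [← hr]; simp,
    fun ε hε => exists_norm_sub_smul_lt_of_mem_spectrum _ hz hr hz0 hε⟩

theorem norm_fourierLaplace_le_of_im_eq_log [Nontrivial H]
    (φ : CompactlySupportedContinuousMap ℝ ℂ) {α : ℂ}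
    (hα : α.im = Real.log (spectralRadius ℂ (P.S 1)).toReal) :
    ‖∫ x : ℝ, φ x * Complex.exp (-(Complex.I * α * x))‖ ≤ ‖P.integralS φ‖ := by
  obtain ⟨z, hz0, hr, happ⟩ := P.exists_approx_eigenvalue_S 1
  refine P.norm_fourierLaplace_le_of_im_eq φ (α₀ := Complex.I * Complex.log z)
    (by simp [hα, hr, Complex.log_re]) fun ε hε => ?_
  obtain ⟨f, hf⟩ := happ (ε * ‖z‖) (by positivity)
  refine ⟨f, ?_⟩
  have he : Complex.exp (Complex.I * (Complex.I * Complex.log z) * (1 : ℝ)) = z⁻¹ := by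
    rw [← mul_assoc, Complex.I_mul_I, Complex.ofReal_one, mul_one, neg_one_mul, Complex.exp_neg,
      Complex.exp_log hz0]
  have h1 : P.orbit (Complex.I * Complex.log z) f 1 - f = z⁻¹ • (P.S 1 f - z • f) := by
    rw [orbit, he, smul_sub, inv_smul_smul₀ hz0]
  rw [h1, norm_smul, norm_inv, inv_mul_lt_iff₀ (by positivity)]
  linarith

theorem norm_fourierLaplace_le_of_im_eq_neg_log [Nontrivial H]
    (φ : CompactlySupportedContinuousMap ℝ ℂ) {α : ℂ}
    (hα : α.im = -Real.log (spectralRadius ℂ (P.S (-1))).toReal) :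
    ‖∫ x : ℝ, φ x * Complex.exp (-(Complex.I * α * x))‖ ≤ ‖P.integralS φ‖ := by
  obtain ⟨z, hz0, hr, happ⟩ := P.exists_approx_eigenvalue_S (-1)
  refine P.norm_fourierLaplace_le_of_im_eq φ (α₀ := -(Complex.I * Complex.log z))
    (by simp [hα, hr, Complex.log_re]) fun ε hε => ?_
  obtain ⟨f, hf⟩ := happ (ε / (‖P.S 1‖ + 1)) (by positivity)
  refine ⟨f, ?_⟩
  have he : Complex.exp (Complex.I * (-(Complex.I * Complex.log z)) * (1 : ℝ)) = z := by
    rw [mul_neg, ← mul_assoc, Complex.I_mul_I, Complex.ofReal_one, mul_one, neg_one_mul, neg_neg,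
      Complex.exp_log hz0]
  have h1 : P.orbit (-(Complex.I * Complex.log z)) f 1 - f = -P.S 1 (P.S (-1) f - z • f) := by
    rw [orbit, he, map_sub, map_smul, ← S_apply_add, add_neg_cancel, P.S_zero]
    simp
  rw [h1, norm_neg]
  calc _ ≤ (‖P.S 1‖ + 1) * ‖P.S (-1) f - z • f‖ :=
        ContinuousLinearMap.le_of_opNorm_le _ (by linarith) _
    _ < (‖P.S 1‖ + 1) * (ε / (‖P.S 1‖ + 1) * ‖f‖) := by gcongr
    _ = _ := by field_simp

theorem ae_eq_zero_of_subsingleton (P : MultiplierSetup H) [Subsingleton H]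
    (φ : CompactlySupportedContinuousMap ℝ ℂ) :
    (φ : ℝ → ℂ) =ᵐ[volume] 0 := by
  have h := P.ofCc_spec φ
  rw [Subsingleton.elim (P.ofCc φ) 0, map_zero] at h
  exact h.symm.trans AEEqFun.coeFn_zero

end MultiplierSetup

/-- **Theorem 4.** For every `φ ∈ C_c(ℝ)` and every `α` in the strip
`Ω = {z : -log ρ(S⁻¹) ≤ Im z ≤ log ρ(S)}`, the Fourier(-Laplace) transform satisfies
`|∫ φ(x) e^(-i α x) dx| ≤ ‖M_φ‖`, where `M_φ` is the convolution operator by `φ` on `H`. -/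
theorem fourier_bound_on_strip {H : Type} [NormedAddCommGroup H]
    [InnerProductSpace ℂ H] [CompleteSpace H] (P : MultiplierSetup H)
    (φ : CompactlySupportedContinuousMap ℝ ℂ) (N : H →L[ℂ] H)
    (hN : ∀ f : H, (P.ι (N f) : ℝ → ℂ) =ᵐ[volume]
      fun x => ∫ y : ℝ, (P.ι f : ℝ → ℂ) (x - y) * φ y)
    (α : ℂ)
    (hα : α.im ∈ Set.Icc (-Real.log ((spectralRadius ℂ (P.S (-1))).toReal))
      (Real.log ((spectralRadius ℂ (P.S 1)).toReal))) :
    ‖∫ x : ℝ, φ x * Complex.exp (-(Complex.I * α * x))‖ ≤ ‖N‖ := by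
  rcases subsingleton_or_nontrivial H with hH | hH
  · have h0 : ∫ x : ℝ, φ x * Complex.exp (-(Complex.I * α * x)) = 0 := by
      refine integral_eq_zero_of_ae ?_
      filter_upwards [P.ae_eq_zero_of_subsingleton φ] with x hx
      simp [hx]
    rw [h0, norm_zero]
    exact norm_nonneg N
  · rw [P.eq_integralS φ N hN]
    exact norm_fourierLaplace_le_of_strip φ
      (fun z hz => P.norm_fourierLaplace_le_of_im_eq_neg_log φ hz)
      (fun z hz => P.norm_fourierLaplace_le_of_im_eq_log φ hz) hα
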